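/- For all nonnegative integers n and k and every real number α, Σ_{m=0}^{n} c(n,m) · (m+α)^k = Σ_{i=0}^{k} Σ_{j=0}^{i} j! · c(n+1, j+1) · C(k,i) · S(i,j) · α^{k−i}, where C(k,i) denotes the binomial coefficient. -/

import Mathlib

/-- Unsigned Stirling numbers of the first kind:
`c(0,0)=1`, `c(n,m)=0` for `m>n` or (`n>0` and `m=0`), and `c(n+1,m)=n*c(n,m)+c(n,m-1)`. -/
def stirling1 : ℕ → ℕ → ℕ
  | 0, 0 => 1
  | 0, _ + 1 => 0
  | _ + 1, 0 => 0
  | n + 1, m + 1 => n * stirling1 n (m + 1) + stirling1 n m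

/-- Stirling numbers of the second kind:
`S(0,0)=1`, `S(n,m)=0` for `m>n` or (`n>0` and `m=0`), and `S(n+1,m)=m*S(n,m)+S(n,m-1)`. -/
def stirling2 : ℕ → ℕ → ℕ
  | 0, 0 => 1
  | 0, _ + 1 => 0
  | _ + 1, 0 => 0
  | n + 1, m + 1 => (m + 1) * stirling2 n (m + 1) + stirling2 n m

/-- Poly-Cauchy numbers of the second kind (negated upper index, unsigned):
`ĉ_{n,k} = Σ_{m=0}^n c(n,m)·(m+1)^k`. -/
def polyCauchy (n k : ℕ) : ℕ := ∑ m ∈ Finset.range (n + 1), stirling1 n m * (m + 1) ^ k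

theorem stirling1_eq_zero_of_lt : ∀ {n m : ℕ}, n < m → stirling1 n m = 0
  | 0, _ + 1, _ => rfl
  | n + 1, m + 1, h => by
    rw [stirling1, stirling1_eq_zero_of_lt (by omega : n < m + 1),
      stirling1_eq_zero_of_lt (by omega : n < m), mul_zero]

theorem stirling2_eq_zero_of_lt : ∀ {n m : ℕ}, n < m → stirling2 n m = 0
  | 0, _ + 1, _ => rfl
  | n + 1, m + 1, h => by
    rw [stirling2, stirling2_eq_zero_of_lt (by omega : n < m + 1),
      stirling2_eq_zero_of_lt (by omega : n < m), mul_zero]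

theorem mul_stirling1_zero_right (n : ℕ) : n * stirling1 n 0 = 0 := by
  cases n <;> simp [stirling1]

/-- Reindexing of a recurrence term: the `m = 0` term is killed by the factor `n`. -/
theorem mul_sum_stirling1_succ (n : ℕ) (f : ℕ → ℕ) :
    n * ∑ m ∈ Finset.range (n + 1), stirling1 n (m + 1) * f (m + 1)
      = n * ∑ m ∈ Finset.range (n + 1), stirling1 n m * f m := by
  have h := Finset.sum_range_succ' (fun m => stirling1 n m * f m) (n + 1)
  rw [Finset.sum_range_succ, stirling1_eq_zero_of_lt n.lt_succ_self, zero_mul, add_zero] at h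
  rw [h, mul_add, ← mul_assoc n (stirling1 n 0), mul_stirling1_zero_right, zero_mul, add_zero]

theorem sum_stirling1_succ_mul (n : ℕ) (f : ℕ → ℕ) :
    ∑ m ∈ Finset.range (n + 2), stirling1 (n + 1) m * f m
      = n * ∑ m ∈ Finset.range (n + 1), stirling1 n m * f m
        + ∑ m ∈ Finset.range (n + 1), stirling1 n m * f (m + 1) := by
  rw [Finset.sum_range_succ', ← mul_sum_stirling1_succ, Finset.mul_sum,
    ← Finset.sum_add_distrib]
  simp only [stirling1, zero_mul, add_zero]
  exact Finset.sum_congr rfl fun m _ => by ring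

theorem sum_stirling1_mul_choose (n j : ℕ) :
    ∑ m ∈ Finset.range (n + 1), stirling1 n m * m.choose j = stirling1 (n + 1) (j + 1) := by
  induction n generalizing j with
  | zero => cases j <;> simp [stirling1]
  | succ n ih =>
    rw [sum_stirling1_succ_mul, ih]
    cases j with
    | zero =>
      have h := ih 0
      simp only [Nat.choose_zero_right] at h ⊢
      rw [h, stirling1.eq_def (n + 2)]
      simp only [stirling1]
      ring
    | succ j =>
      simp only [Nat.choose_succ_succ', mul_add, Finset.sum_add_distrib, ih]
      rw [stirling1.eq_def (n + 2)]
      ring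

/-- Powers expanded in falling factorials. -/
theorem pow_eq_sum_stirling2_mul_descFactorial (m i : ℕ) :
    m ^ i = ∑ j ∈ Finset.range (i + 1), stirling2 i j * m.descFactorial j := by
  induction i with
  | zero => simp [stirling2]
  | succ i ih =>
    have hm (j : ℕ) : m.descFactorial j * m = m.descFactorial (j + 1) + j * m.descFactorial j := by
      rw [Nat.descFactorial_succ]
      rcases le_or_gt j m with h | h
      · rw [← add_mul, Nat.sub_add_cancel h, mul_comm]
      · simp [Nat.descFactorial_of_lt h]
    have hshift := Finset.sum_range_succ' (fun j => j * stirling2 i j * m.descFactorial j) (i + 1)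
    rw [Finset.sum_range_succ, stirling2_eq_zero_of_lt i.lt_succ_self] at hshift
    simp only [mul_zero, zero_mul, add_zero] at hshift
    rw [pow_succ, ih, Finset.sum_mul, Finset.sum_range_succ' _ (i + 1)]
    simp only [stirling2, zero_mul, add_zero]
    calc ∑ j ∈ Finset.range (i + 1), stirling2 i j * m.descFactorial j * m
        = ∑ j ∈ Finset.range (i + 1), stirling2 i j * m.descFactorial (j + 1)
          + ∑ j ∈ Finset.range (i + 1), j * stirling2 i j * m.descFactorial j := by
          rw [← Finset.sum_add_distrib]
          exact Finset.sum_congr rfl fun j _ => by rw [mul_assoc, hm]; ring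
      _ = _ := by
          rw [hshift, ← Finset.sum_add_distrib]
          exact Finset.sum_congr rfl fun j _ => by ring

theorem sum_stirling1_mul_pow (n i : ℕ) :
    ∑ m ∈ Finset.range (n + 1), stirling1 n m * m ^ i
      = ∑ j ∈ Finset.range (i + 1), j.factorial * stirling1 (n + 1) (j + 1) * stirling2 i j := by
  simp only [pow_eq_sum_stirling2_mul_descFactorial _ i, Nat.descFactorial_eq_factorial_mul_choose,
    ← sum_stirling1_mul_choose n, Finset.mul_sum, Finset.sum_mul]
  rw [Finset.sum_comm]
  exact Finset.sum_congr rfl fun j _ => Finset.sum_congr rfl fun m _ => by ring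

theorem shifted_polyCauchy_closed_formula (n k : ℕ) (α : ℝ) :
    ∑ m ∈ Finset.range (n + 1), (stirling1 n m : ℝ) * ((m : ℝ) + α) ^ k
      = ∑ i ∈ Finset.range (k + 1), ∑ j ∈ Finset.range (i + 1),
        (Nat.factorial j : ℝ) * (stirling1 (n + 1) (j + 1) : ℝ) * (Nat.choose k i : ℝ)
          * (stirling2 i j : ℝ) * α ^ (k - i) := by
  simp only [add_pow, Finset.mul_sum]
  rw [Finset.sum_comm]
  refine Finset.sum_congr rfl fun i _ => ?_
  have h := congrArg (fun x : ℕ => (x : ℝ) * (k.choose i * α ^ (k - i))) (sum_stirling1_mul_pow n i)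
  push_cast [Finset.sum_mul] at h
  convert h using 2 <;> ring
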